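/- Soundness and completeness of nPC: for every i ∈ {1,…,n}, every set Γ of nPC formulas, and every nPC formula F, Γ ⊨_i F if and only if the sequent Γ ⊢_i F is provable in nPC. -/

import Mathlib

/-- Formulas of the n-dimensional propositional calculus nPC:
decorated variables `X^π`, constants `e_k`, and compounds `q(F,G_1,…,G_n)`.
Dimensions are elements of `Fin n`; propositional variables are natural numbers. -/
inductive Fm (n : ℕ) : Type where
  | var (X : ℕ) (π : Equiv.Perm (Fin n)) : Fm n
  | const (k : Fin n) : Fm n
  | q (F : Fm n) (G : Fin n → Fm n) : Fm n

/-- The action `F^ρ` of a permutation `ρ` on a formula. -/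
def Fm.act {n : ℕ} (ρ : Equiv.Perm (Fin n)) : Fm n → Fm n
  | .var X π => .var X (ρ * π)
  | .const k => .const (ρ k)
  | .q F G => .q F (fun j => (G j).act ρ)

/-- The action of a permutation on a multiset of formulas (context). -/
def actM {n : ℕ} (ρ : Equiv.Perm (Fin n)) (Γ : Multiset (Fm n)) : Multiset (Fm n) :=
  Γ.map (Fm.act ρ)

/-- The sequent calculus of nPC: `Proves Γ i Δ` means the sequent `Γ ⊢_i Δ` is provable. -/
inductive Proves {n : ℕ} : Multiset (Fm n) → Fin n → Multiset (Fm n) → Prop where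
  | const (i : Fin n) : Proves 0 i {Fm.const i}
  | id (X : ℕ) (π ρ : Equiv.Perm (Fin n)) (i : Fin n) (h : π⁻¹ i = ρ⁻¹ i) :
      Proves {Fm.var X π} i {Fm.var X ρ}
  | sym (Γ Δ : Multiset (Fm n)) (i j : Fin n)
      (h : Proves (actM (Equiv.swap i j) Γ) i (actM (Equiv.swap i j) Δ)) :
      Proves Γ j Δ
  | neg1 (Γ Δ : Multiset (Fm n)) (F : Fm n) (i j k : Fin n) (hik : i ≠ k)
      (h : Proves (actM (Equiv.swap i j) Γ) i (F ::ₘ actM (Equiv.swap i j) Δ)) :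
      Proves (F.act (Equiv.swap j k) ::ₘ Γ) j Δ
  | neg2 (Γ Δ : Multiset (Fm n)) (F : Fm n) (i j k : Fin n) (hjk : j ≠ k)
      (h : Proves (actM (Equiv.swap i j) Γ) i (F ::ₘ actM (Equiv.swap i j) Δ)) :
      Proves (F.act (Equiv.swap i k) ::ₘ Γ) j Δ
  | neg3 (Γ Δ : Multiset (Fm n)) (F : Fm n) (j : Fin n)
      (h : ∀ i : Fin n, i ≠ j →
        Proves (F ::ₘ actM (Equiv.swap i j) Γ) i (actM (Equiv.swap i j) Δ)) :
      Proves Γ j (F ::ₘ Δ)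
  | qL (Γ Δ : Multiset (Fm n)) (F : Fm n) (G : Fin n → Fm n) (i : Fin n)
      (h : ∀ j : Fin n,
        Proves ((G j).act (Equiv.swap j i) ::ₘ F ::ₘ actM (Equiv.swap j i) Γ) j
          (actM (Equiv.swap j i) Δ)) :
      Proves (Fm.q F G ::ₘ Γ) i Δ
  | qR (Γ Δ : Multiset (Fm n)) (F : Fm n) (G : Fin n → Fm n) (i : Fin n)
      (h : ∀ j : Fin n,
        Proves (F ::ₘ actM (Equiv.swap j i) Γ) j
          ((G j).act (Equiv.swap j i) ::ₘ actM (Equiv.swap j i) Δ)) :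
      Proves Γ i (Fm.q F G ::ₘ Δ)
  | cut (Γ Δ : Multiset (Fm n)) (F : Fm n) (i : Fin n)
      (h1 : Proves (F ::ₘ Γ) i Δ) (h2 : Proves Γ i (F ::ₘ Δ)) : Proves Γ i Δ
  | weakL (Γ Δ : Multiset (Fm n)) (F : Fm n) (i : Fin n)
      (h : Proves Γ i Δ) : Proves (F ::ₘ Γ) i Δ
  | weakR (Γ Δ : Multiset (Fm n)) (F : Fm n) (i : Fin n)
      (h : Proves Γ i Δ) : Proves Γ i (F ::ₘ Δ)
  | conL (Γ Δ : Multiset (Fm n)) (F : Fm n) (i : Fin n)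
      (h : Proves (F ::ₘ F ::ₘ Γ) i Δ) : Proves (F ::ₘ Γ) i Δ
  | conR (Γ Δ : Multiset (Fm n)) (F : Fm n) (i : Fin n)
      (h : Proves Γ i (F ::ₘ F ::ₘ Δ)) : Proves Γ i (F ::ₘ Δ)

/-- The semantics `⟦F⟧v` of a formula in an environment `v`. -/
def Fm.sem {n : ℕ} (v : ℕ → Fin n) : Fm n → Fin n
  | .var X π => π (v X)
  | .const k => k
  | .q F G => (G (F.sem v)).sem v

/-- `Γ ⊨_i Δ`: every environment making all of `Γ` equal `i` makes some formula of `Δ` equal `i`. -/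
def Models {n : ℕ} (Γ : Multiset (Fm n)) (i : Fin n) (Δ : Multiset (Fm n)) : Prop :=
  ∀ v : ℕ → Fin n, (∀ G ∈ Γ, Fm.sem v G = i) → ∃ F ∈ Δ, Fm.sem v F = i

/-- Logical equivalence `F ∼ G`: both `F ⊢_i G` and `G ⊢_i F` are provable for every `i`. -/
def Eqv {n : ℕ} (F G : Fm n) : Prop :=
  ∀ i : Fin n, Proves {F} i {G} ∧ Proves {G} i {F}

/-- Provability from a (possibly infinite) set of hypotheses:
some finite sub-multiset of `Γ` proves `Δ` at `i`. -/
def ProvesSet {n : ℕ} (Γ : Set (Fm n)) (i : Fin n) (Δ : Multiset (Fm n)) : Prop :=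
  ∃ Γ' : Multiset (Fm n), (∀ G ∈ Γ', G ∈ Γ) ∧ Proves Γ' i Δ

/-- `Γ ⊨_i F` for a set `Γ` of hypotheses. -/
def ModelsSet {n : ℕ} (Γ : Set (Fm n)) (i : Fin n) (F : Fm n) : Prop :=
  ∀ v : ℕ → Fin n, (∀ G ∈ Γ, Fm.sem v G = i) → Fm.sem v F = i

namespace Fm

variable {n : ℕ}

@[simp] theorem act_one (F : Fm n) : F.act 1 = F := by
  induction F with
  | var X π => simp [act]
  | const k => simp [act]
  | q F G _ ihG => simp [act, ihG]

@[simp] theorem act_act (σ ρ : Equiv.Perm (Fin n)) (F : Fm n) :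
    (F.act ρ).act σ = F.act (σ * ρ) := by
  induction F with
  | var X π => simp [act, mul_assoc]
  | const k => simp [act]
  | q F G _ ihG => simp [act, ihG]

@[simp] theorem sem_act (v : ℕ → Fin n) (ρ : Equiv.Perm (Fin n)) (F : Fm n) :
    (F.act ρ).sem v = ρ (F.sem v) := by
  induction F with
  | var X π => simp [act, sem]
  | const k => simp [act, sem]
  | q F G _ ihG => simp [act, sem, ihG]

end Fm

section Context

variable {n : ℕ}

@[simp] theorem actM_cons (ρ : Equiv.Perm (Fin n)) (F : Fm n) (Γ : Multiset (Fm n)) :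
    actM ρ (F ::ₘ Γ) = F.act ρ ::ₘ actM ρ Γ := by
  simp [actM]

@[simp] theorem actM_swap_actM_swap (i j : Fin n) (Γ : Multiset (Fm n)) :
    actM (Equiv.swap i j) (actM (Equiv.swap i j) Γ) = Γ := by
  simp [actM, Multiset.map_map]

theorem exists_mem_cons {α : Type*} {p : α → Prop} {a : α} {s : Multiset α} :
    (∃ x ∈ a ::ₘ s, p x) ↔ p a ∨ ∃ x ∈ s, p x := by
  simp

theorem swap_apply_eq_left_iff (i j a : Fin n) : Equiv.swap i j a = i ↔ a = j := by
  rw [← Equiv.apply_eq_iff_eq (Equiv.swap i j), Equiv.swap_apply_self, Equiv.swap_apply_left]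

theorem forall_mem_actM_swap (v : ℕ → Fin n) (i j : Fin n) (Γ : Multiset (Fm n)) :
    (∀ G ∈ actM (Equiv.swap i j) Γ, G.sem v = i) ↔ ∀ G ∈ Γ, G.sem v = j := by
  simp [actM, swap_apply_eq_left_iff]

theorem exists_mem_actM_swap (v : ℕ → Fin n) (i j : Fin n) (Γ : Multiset (Fm n)) :
    (∃ G ∈ actM (Equiv.swap i j) Γ, G.sem v = i) ↔ ∃ G ∈ Γ, G.sem v = j := by
  simp [actM, swap_apply_eq_left_iff]

end Context

namespace Proves

variable {n : ℕ} {Γ Γ' Δ Δ' : Multiset (Fm n)} {i : Fin n}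

theorem sound (h : Proves Γ i Δ) : Models Γ i Δ := by
  induction h with
  | const i => intro v _; exact ⟨_, Multiset.mem_singleton_self _, rfl⟩
  | id X π ρ i h =>
    intro v hv
    refine ⟨_, Multiset.mem_singleton_self _, ?_⟩
    have hX : π (v X) = i := hv _ (Multiset.mem_singleton_self _)
    rw [Equiv.Perm.inv_eq_iff_eq.2 hX.symm] at h
    simp [Fm.sem, h]
  | sym Γ Δ i j _ ih =>
    intro v hv
    exact (exists_mem_actM_swap v i j Δ).1 (ih v ((forall_mem_actM_swap v i j Γ).2 hv))
  | neg1 Γ Δ F i j k hik _ ih =>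
    intro v hv
    simp only [Multiset.forall_mem_cons, Fm.sem_act, swap_apply_eq_left_iff] at hv
    have := ih v ((forall_mem_actM_swap v i j Γ).2 hv.2)
    simp only [exists_mem_cons, exists_mem_actM_swap] at this
    exact this.resolve_left fun hF => hik (hF.symm.trans hv.1)
  | neg2 Γ Δ F i j k hjk _ ih =>
    intro v hv
    simp only [Multiset.forall_mem_cons, Fm.sem_act] at hv
    have := ih v ((forall_mem_actM_swap v i j Γ).2 hv.2)
    simp only [exists_mem_cons, exists_mem_actM_swap] at this
    refine this.resolve_left fun hF => hjk ?_
    rw [← hv.1, hF, Equiv.swap_apply_left]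
  | neg3 Γ Δ F j _ ih =>
    intro v hv
    rw [exists_mem_cons]
    by_cases hF : F.sem v = j
    · exact Or.inl hF
    · refine Or.inr ((exists_mem_actM_swap v _ j Δ).1 (ih _ hF v ?_))
      rw [Multiset.forall_mem_cons, forall_mem_actM_swap]
      exact ⟨rfl, hv⟩
  | qL Γ Δ F G i _ ih =>
    intro v hv
    rw [Multiset.forall_mem_cons] at hv
    refine (exists_mem_actM_swap v _ i Δ).1 (ih (F.sem v) v ?_)
    simp only [Multiset.forall_mem_cons, forall_mem_actM_swap, Fm.sem_act,
      swap_apply_eq_left_iff, true_and]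
    exact hv
  | qR Γ Δ F G i _ ih =>
    intro v hv
    have := ih (F.sem v) v (by
      rw [Multiset.forall_mem_cons, forall_mem_actM_swap]
      exact ⟨rfl, hv⟩)
    simpa only [exists_mem_cons, exists_mem_actM_swap, Fm.sem_act, Fm.sem,
      swap_apply_eq_left_iff] using this
  | cut Γ Δ F i _ _ ih₁ ih₂ =>
    intro v hv
    rcases (exists_mem_cons).1 (ih₂ v hv) with hF | hΔ
    · exact ih₁ v ((Multiset.forall_mem_cons).2 ⟨hF, hv⟩)
    · exact hΔ
  | weakL Γ Δ F i _ ih =>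
    intro v hv
    exact ih v ((Multiset.forall_mem_cons).1 hv).2
  | weakR Γ Δ F i _ ih =>
    intro v hv
    exact (exists_mem_cons).2 (Or.inr (ih v hv))
  | conL Γ Δ F i _ ih =>
    intro v hv
    exact ih v ((Multiset.forall_mem_cons).2 ⟨hv _ (Multiset.mem_cons_self _ _), hv⟩)
  | conR Γ Δ F i _ ih =>
    intro v hv
    simpa [exists_mem_cons] using ih v hv

theorem add_left (h : Proves Γ i Δ) (Γ' : Multiset (Fm n)) : Proves (Γ' + Γ) i Δ := by
  induction Γ' using Multiset.induction with
  | empty => simpa using h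
  | cons F Γ' ih => rw [Multiset.cons_add]; exact weakL _ _ _ _ ih

theorem add_right (h : Proves Γ i Δ) (Δ' : Multiset (Fm n)) : Proves Γ i (Δ' + Δ) := by
  induction Δ' using Multiset.induction with
  | empty => simpa using h
  | cons F Δ' ih => rw [Multiset.cons_add]; exact weakR _ _ _ _ ih

theorem absorb_left (h : Proves (Γ + Γ') i Δ) (hΓ : Γ ⊆ Γ') : Proves Γ' i Δ := by
  induction Γ using Multiset.induction with
  | empty => simpa using h
  | cons F Γ ih =>
    rw [Multiset.cons_subset] at hΓ
    refine ih ?_ hΓ.2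
    obtain ⟨Γ'', rfl⟩ := Multiset.exists_cons_of_mem hΓ.1
    rw [Multiset.add_cons]
    refine conL _ _ _ _ ?_
    rwa [Multiset.cons_add, Multiset.add_cons] at h

theorem absorb_right (h : Proves Γ i (Δ + Δ')) (hΔ : Δ ⊆ Δ') : Proves Γ i Δ' := by
  induction Δ using Multiset.induction with
  | empty => simpa using h
  | cons F Δ ih =>
    rw [Multiset.cons_subset] at hΔ
    refine ih ?_ hΔ.2
    obtain ⟨Δ'', rfl⟩ := Multiset.exists_cons_of_mem hΔ.1
    rw [Multiset.add_cons]
    refine conR _ _ _ _ ?_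
    rwa [Multiset.cons_add, Multiset.add_cons] at h

theorem mono (h : Proves Γ i Δ) (hΓ : Γ ⊆ Γ') (hΔ : Δ ⊆ Δ') : Proves Γ' i Δ' := by
  have hL : Proves Γ' i Δ := absorb_left (by rw [add_comm]; exact h.add_left Γ') hΓ
  exact absorb_right (by rw [add_comm]; exact hL.add_right Δ') hΔ

/-- Case analysis on the value of `F`: the formula `F^{(ji)}` has value `i` iff `F` has value `j`. -/
theorem of_cases (F : Fm n)
    (h : ∀ j, Proves (F.act (Equiv.swap j i) ::ₘ Γ) i Δ) : Proves Γ i Δ := by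
  refine cut _ _ F _ (by simpa [← Equiv.Perm.one_def] using h i) (neg3 _ _ _ _ fun k _ => ?_)
  refine sym _ _ i k ?_
  simpa [Equiv.swap_comm i k] using h k

theorem refute {F : Fm n} {a : Fin n} (ha : a ≠ i)
    (h : Proves (actM (Equiv.swap a i) Γ) a {F}) : Proves (F ::ₘ Γ) i 0 := by
  simpa [← Equiv.Perm.one_def] using neg1 Γ 0 F a i i ha h

/-- `Γ` fixes, at index `i`, the values that `v` assigns to the variables below `N`. -/
def _root_.Pins (v : ℕ → Fin n) (N : ℕ) (i : Fin n) (Γ : Multiset (Fm n)) : Prop :=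
  ∀ X < N, ∃ σ : Equiv.Perm (Fin n), Fm.var X σ ∈ Γ ∧ σ (v X) = i

theorem _root_.Pins.actM {v : ℕ → Fin n} {N : ℕ} (h : Pins v N i Γ) (ρ : Equiv.Perm (Fin n)) :
    Pins v N (ρ i) (actM ρ Γ) := by
  intro X hX
  obtain ⟨σ, hσ, hv⟩ := h X hX
  exact ⟨ρ * σ, Multiset.mem_map_of_mem (Fm.act ρ) hσ, by simp [hv]⟩

theorem _root_.Pins.mono {v : ℕ → Fin n} {M N : ℕ} (h : Pins v N i Γ) (hM : M ≤ N)
    (hΓ : Γ ⊆ Γ') : Pins v M i Γ' := by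
  intro X hX
  obtain ⟨σ, hσ, hv⟩ := h X (hX.trans_le hM)
  exact ⟨σ, hΓ hσ, hv⟩

/-- A context pinning enough variables proves the value of a formula. -/
theorem exists_bound_of_pins (v : ℕ → Fin n) (F : Fm n) :
    ∃ N, ∀ (π : Equiv.Perm (Fin n)) (i : Fin n) (Γ : Multiset (Fm n)),
      Pins v N i Γ → π (F.sem v) = i → Proves Γ i {F.act π} := by
  induction F with
  | var X τ =>
    refine ⟨X + 1, fun π i Γ hΓ hi => ?_⟩
    obtain ⟨σ, hσ, hv⟩ := hΓ X X.lt_succ_self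
    refine (Proves.id X σ (π * τ) i ?_).mono (by simpa using hσ) (Multiset.Subset.refl _)
    have hτ : (π * τ) (v X) = i := hi
    rw [Equiv.Perm.inv_eq_iff_eq.2 hv.symm, Equiv.Perm.inv_eq_iff_eq.2 hτ.symm]
  | const k =>
    refine ⟨0, fun π i Γ _ hi => ?_⟩
    have hk : π k = i := hi
    simp only [Fm.act, hk]
    exact (Proves.const i).mono (Multiset.zero_subset _) (Multiset.Subset.refl _)
  | q F G ihF ihG =>
    obtain ⟨M, hM⟩ := ihF
    obtain ⟨N, hN⟩ := ihG (F.sem v)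
    refine ⟨max M N, fun π i Γ hΓ hi => qR Γ 0 F _ i fun j => ?_⟩
    have hΓj : Pins v (max M N) j (_root_.actM (Equiv.swap j i) Γ) := by
      simpa using hΓ.actM (Equiv.swap j i)
    by_cases hj : F.sem v = j
    · subst hj
      have hG : π ((G (F.sem v)).sem v) = i := hi
      rw [Fm.act_act]
      exact hN _ _ _ (hΓj.mono (le_max_right M N) (Multiset.subset_cons _ _)) (by simp [hG])
    · refine (refute hj ?_).mono (Multiset.Subset.refl _) (Multiset.zero_subset _)
      have := hM 1 (F.sem v) _
        (by simpa using (hΓj.mono (le_max_left M N) (Multiset.Subset.refl _)).actM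
              (Equiv.swap (F.sem v) j)) rfl
      simpa using this

/-- Unprovability extends to a context that pins an environment. -/
theorem exists_pins_of_not_provesSet {Γ : Set (Fm n)} {F : Fm n}
    (h : ¬ ProvesSet Γ i {F}) :
    ∃ v : ℕ → Fin n, ∀ N, ∃ L, Pins v N i L ∧
      ∀ Γ' : Multiset (Fm n), (∀ G ∈ Γ', G ∈ Γ) → ¬ Proves (Γ' + L) i {F} := by
  let P (L : Multiset (Fm n)) : Prop :=
    ∀ Γ' : Multiset (Fm n), (∀ G ∈ Γ', G ∈ Γ) → ¬ Proves (Γ' + L) i {F}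
  have step : ∀ (L : {L // P L}) (X : ℕ),
      ∃ j : Fin n, P (Fm.var X (Equiv.swap j i) ::ₘ L.1) := by
    rintro ⟨L, hL⟩ X
    by_contra! hcon
    simp only [P, not_forall, not_not] at hcon
    choose Γ' hΓ' hp using hcon
    refine hL (∑ j, Γ' j) (fun G hG => ?_) (of_cases (Fm.var X 1) fun j => ?_)
    · obtain ⟨j, -, hj⟩ := Multiset.mem_sum.1 hG
      exact hΓ' j G hj
    · refine (hp j).mono (fun G hG => ?_) (Multiset.Subset.refl _)
      simp only [Multiset.mem_add, Multiset.mem_cons, Multiset.mem_sum, Finset.mem_univ,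
        true_and, Fm.act, mul_one] at hG ⊢
      rcases hG with hG | hG | hG
      · exact Or.inr (Or.inl ⟨j, hG⟩)
      · exact Or.inl hG
      · exact Or.inr (Or.inr hG)
  choose f hf using step
  let S : ℕ → {L // P L} := fun N => Nat.rec
    ⟨0, fun Γ' hΓ' hp => h ⟨Γ', hΓ', by simpa using hp⟩⟩ (fun m L => ⟨_, hf L m⟩) N
  have hS : ∀ m, (S (m + 1)).1 = Fm.var m (Equiv.swap (f (S m) m) i) ::ₘ (S m).1 := fun _ => rfl
  refine ⟨fun m => f (S m) m, fun N => ⟨(S N).1, ?_, (S N).2⟩⟩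
  induction N with
  | zero => intro X hX; exact absurd hX X.not_lt_zero
  | succ m ih =>
    intro X hX
    rw [hS]
    rcases Nat.lt_succ_iff_lt_or_eq.1 hX with hX | rfl
    · exact ih.mono le_rfl (Multiset.subset_cons _ _) X hX
    · exact ⟨_, Multiset.mem_cons_self _ _, Equiv.swap_apply_left _ _⟩

end Proves

/-- Soundness and completeness of nPC: `Γ ⊨_i F` iff `Γ ⊢_i F` is provable. -/
theorem nPC_soundness_completeness (n : ℕ) (hn : 2 ≤ n) (i : Fin n)
    (Γ : Set (Fm n)) (F : Fm n) :
    ModelsSet Γ i F ↔ ProvesSet Γ i {F} := by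
  constructor
  · intro hmodels
    by_contra hnot
    obtain ⟨v, hv⟩ := Proves.exists_pins_of_not_provesSet hnot
    have hΓ : ∀ G ∈ Γ, G.sem v = i := by
      intro G hG
      by_contra hne
      obtain ⟨N, hN⟩ := Proves.exists_bound_of_pins v G
      obtain ⟨L, hL, hunprov⟩ := hv N
      have hG' : Proves (actM (Equiv.swap (G.sem v) i) L) (G.sem v) {G} := by
        simpa using hN 1 (G.sem v) _ (by simpa using hL.actM (Equiv.swap (G.sem v) i)) rfl
      refine hunprov {G} (by simpa using hG) ?_
      rw [Multiset.singleton_add]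
      exact (Proves.refute hne hG').mono (Multiset.Subset.refl _) (Multiset.zero_subset _)
    obtain ⟨N, hN⟩ := Proves.exists_bound_of_pins v F
    obtain ⟨L, hL, hunprov⟩ := hv N
    exact hunprov 0 (by simp) (by simpa using hN 1 i L hL (hmodels v hΓ))
  · rintro ⟨Γ', hsub, hp⟩ v hv
    simpa using hp.sound v fun G hG => hv G (hsub G hG)
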